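/- Let M be a two-dimensional Riemannian model with metric ds² = dr² + ψ²(r)dθ², set S = ψ, and suppose (i) for every A > 1 there is c > 0 such that sup_{t∈(A^{-1}r, Ar)} S''₊(t)/S(t) ≤ c S''₊(r)/S(r) for all large r, and (ii) there is N > 0 with S(r)/r + √(S''₊(r) S(r)) ≤ N log r for all large r. Then M satisfies the spherical Harnack inequality: there exist r₀, C_H, N_H > 0 and A > 1 such that every positive harmonic function u on M ∖ closure(B(x₀, A^{-1}r)) with r ≥ r₀ satisfies sup_{∂B(x₀,r)} u ≤ C_H r^{N_H} inf_{∂B(x₀,r)} u. -/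

import Mathlib

open Set Real

open Filter Topology Metric InnerProductSpace in
lemma aux_harnack_ball (w : ℂ → ℝ) (c : ℂ) (R : ℝ) (hR : 0 < R)
    (hw : HarmonicOnNhd w (ball c R)) (hpos : ∀ z ∈ ball c R, 0 < w z)
    (z : ℂ) (hz : ‖z‖ ≤ R / 2) : w (c + z) ≤ 3 * w c := by
  obtain ⟨F, hF, hFw⟩ := hw.exists_analyticOnNhd_ball_re_eq
  have hmem : ∀ y ∈ ball (0:ℂ) R, c + y ∈ ball c R := by
    intro y hy
    simpa [mem_ball, dist_eq_norm] using hy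
  have hM : 0 < w c := hpos c (mem_ball_self hR)
  have hc : (F c).re = w c := hFw (mem_ball_self hR)
  have hzb : z ∈ ball (0:ℂ) R := by
    rw [mem_ball_zero_iff]; linarith
  have key := Complex.borelCaratheodory_zero (f := fun y => F c - F (c + y)) (M := w c) (R := R)
    (z := z) hM ?_ ?_ hR hzb (by simp)
  · have h1 : w (c + z) - w c ≤ ‖F c - F (c + z)‖ := by
      have h2 : (F (c + z)).re = w (c + z) := hFw (hmem z hzb)
      have := Complex.abs_re_le_norm (F c - F (c + z))
      rw [Complex.sub_re, hc, h2] at this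
      have := (abs_le.mp this).1
      linarith
    have h3 : 2 * w c * ‖z‖ / (R - ‖z‖) ≤ 2 * w c := by
      rw [div_le_iff₀ (by linarith)]
      nlinarith
    linarith
  · intro y hy
    have h1 : DifferentiableAt ℂ F (c + y) := (hF _ (hmem y hy)).differentiableAt
    apply DifferentiableAt.differentiableWithinAt
    apply DifferentiableAt.sub (by fun_prop)
    exact DifferentiableAt.comp y h1 (by fun_prop)
  · intro y hy
    have h2 : (F (c + y)).re = w (c + y) := hFw (hmem y hy)
    have := hpos _ (hmem y hy)
    show (F c - F (c + y)).re ≤ w c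
    rw [Complex.sub_re, hc, h2]
    linarith

lemma aux_chain (f : ℝ → ℝ) (h : ℝ)
    (hf : ∀ x y, |x - y| ≤ h → f x ≤ 3 * f y) (n : ℕ) :
    ∀ x y, |x - y| ≤ (n + 1) * h → f x ≤ 3 ^ (n + 1) * f y := by
  induction n with
  | zero => intro x y hxy; simpa using hf x y (by simpa using hxy)
  | succ k ih =>
    intro x y hxy
    push_cast at hxy
    have hk : (0:ℝ) < (k:ℝ) + 1 + 1 := by positivity
    set z := x + (y - x) / ((k:ℝ) + 1 + 1) with hz
    have e1 : x - z = (x - y) / ((k:ℝ) + 1 + 1) := by rw [hz]; ring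
    have e2 : z - y = (x - y) / ((k:ℝ) + 1 + 1) * (k + 1) := by rw [hz]; field_simp; ring
    have h0 : |x - z| ≤ h := by
      rw [e1, abs_div, abs_of_pos hk, div_le_iff₀ hk]; linarith
    have h1 : |z - y| ≤ (k + 1) * h := by
      rw [e2, abs_mul, ← e1, abs_of_pos (by positivity : (0:ℝ) < (k:ℝ) + 1)]
      nlinarith
    have a := hf x z h0
    have b := ih z y h1
    calc f x ≤ 3 * f z := a
      _ ≤ 3 * (3 ^ (k + 1) * f y) := by linarith
      _ = _ := by ring

open Filter Topology in
lemma aux_ode (S : ℝ → ℝ) (hS : Continuous S) (r K : ℝ) (hr : 0 < r) (hK : 0 < K)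
    (hpos : ∀ t > 0, 0 < S t) (hb : ∀ t ∈ Icc (r / 2) (2 * r), S t ≤ K) :
    ∃ T : ℝ → ℝ, T 0 = r ∧ ∀ x, |x| < r / (2 * K) →
      T x ∈ Ioo (r / 2) (2 * r) ∧ HasDerivAt T (S (T x)) x := by
  set cl : ℝ → ℝ := fun t => max (r / 2) (min t (2 * r)) with hcl
  have hclm : ∀ t, cl t ∈ Icc (r / 2) (2 * r) := fun t =>
    ⟨le_max_left _ _, max_le (by linarith) (min_le_right _ _)⟩
  have hclpos : ∀ t, 0 < S (cl t) := fun t => hpos _ (by have := (hclm t).1; linarith)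
  have hclc : Continuous cl := by fun_prop
  have hgc : Continuous fun t => (S (cl t))⁻¹ :=
    (hS.comp hclc).inv₀ fun t => (hclpos t).ne'
  set ρ : ℝ → ℝ := fun t => ∫ s in r..t, (S (cl s))⁻¹ with hρ
  have hd : ∀ t, HasDerivAt ρ (S (cl t))⁻¹ t := fun t =>
    intervalIntegral.integral_hasDerivAt_right (hgc.intervalIntegrable _ _)
      (hgc.stronglyMeasurableAtFilter _ _) hgc.continuousAt
  have hρr : ρ r = 0 := by simp [hρ]
  have hmono : StrictMono ρ := strictMono_of_deriv_pos fun t => by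
    rw [(hd t).deriv]; exact inv_pos.mpr (hclpos t)
  have hm2 : Monotone fun t => ρ t - K⁻¹ * t := by
    apply monotone_of_deriv_nonneg
    · intro t; exact ((hd t).sub ((hasDerivAt_id t).const_mul K⁻¹)).differentiableAt
    · intro t
      have := ((hd t).sub ((hasDerivAt_id t).const_mul K⁻¹)).deriv
      have e : deriv (fun t => ρ t - K⁻¹ * t) t = (S (cl t))⁻¹ - K⁻¹ * 1 := this
      rw [e, mul_one, sub_nonneg]
      exact inv_anti₀ (hclpos t) (hb _ (hclm t))
  have hKi : 0 < K⁻¹ := inv_pos.mpr hK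
  have htop : Tendsto ρ atTop atTop := by
    refine tendsto_atTop_mono' _ ?_ (tendsto_atTop_add_const_right _ (- (K⁻¹ * r))
      (tendsto_id.const_mul_atTop hKi))
    filter_upwards [eventually_ge_atTop r] with t ht
    have := hm2 ht
    simp only [hρr] at this
    simp only [id]; linarith
  have hbot : Tendsto ρ atBot atBot := by
    refine tendsto_atBot_mono' _ ?_ (tendsto_atBot_add_const_right _ (- (K⁻¹ * r))
      (tendsto_id.const_mul_atBot hKi))
    filter_upwards [eventually_le_atBot r] with t ht
    have := hm2 ht
    simp only [hρr] at this
    simp only [id]; linarith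
  have hρc : Continuous ρ := continuous_iff_continuousAt.mpr fun t => (hd t).continuousAt
  have hsurj : Function.Surjective ρ := hρc.surjective htop hbot
  set e := hmono.orderIsoOfSurjective ρ hsurj with he
  have hee : ∀ t, e t = ρ t := fun t => rfl
  have hTd : ∀ x, HasDerivAt (fun x => e.symm x) (S (cl (e.symm x))) x := by
    intro x
    have h := HasDerivAt.of_local_left_inverse (f := ρ) (g := fun x => e.symm x) (a := x)
      e.symm.continuous.continuousAt (hd _) (inv_ne_zero (hclpos _).ne')
      (Eventually.of_forall fun y => e.apply_symm_apply y)
    simpa using h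
  have hT0 : e.symm 0 = r := by
    rw [← hρr, ← hee, e.symm_apply_apply]
  refine ⟨fun x => e.symm x, hT0, fun x hx => ?_⟩
  have hmv : |e.symm x - r| ≤ K * |x| := by
    have := Convex.norm_image_sub_le_of_norm_hasDerivWithin_le (f := fun x => e.symm x)
      (s := univ) (C := K) (x := 0) (y := x) (fun y _ => (hTd y).hasDerivWithinAt)
      (fun y _ => by
        rw [Real.norm_eq_abs, abs_of_pos (hclpos _)]; exact hb _ (hclm _))
      convex_univ (mem_univ _) (mem_univ _)
    simpa [hT0] using this
  have hlt : |e.symm x - r| < r / 2 := by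
    rw [lt_div_iff₀ (by positivity)] at hx
    linarith
  have hab := abs_lt.mp hlt
  have hmem : e.symm x ∈ Ioo (r / 2) (2 * r) := ⟨by linarith, by linarith⟩
  refine ⟨hmem, ?_⟩
  have h := hTd x
  have hc : cl (e.symm x) = e.symm x := by
    simp only [hcl]
    rw [min_eq_left hmem.2.le, max_eq_right hmem.1.le]
  rwa [hc] at h

lemma aux_contDiffOn (S T : ℝ → ℝ) (hS : ContDiff ℝ 2 S) (J : Set ℝ) (hJ : IsOpen J)
    (hT : ∀ x ∈ J, HasDerivAt T (S (T x)) x) : ContDiffOn ℝ 2 T J := by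
  have hd : DifferentiableOn ℝ T J := fun x hx => (hT x hx).differentiableAt.differentiableWithinAt
  have hder : EqOn (deriv T) (S ∘ T) J := fun x hx => (hT x hx).deriv
  have h1 : ContDiffOn ℝ 1 T J := by
    rw [show (1 : WithTop ℕ∞) = 0 + 1 by norm_num, contDiffOn_succ_iff_deriv_of_isOpen hJ]
    refine ⟨hd, by simp, ?_⟩
    rw [contDiffOn_zero]
    exact (hS.continuous.comp_continuousOn hd.continuousOn).congr hder
  rw [show (2 : WithTop ℕ∞) = 1 + 1 by norm_num, contDiffOn_succ_iff_deriv_of_isOpen hJ]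
  refine ⟨hd, by simp, ?_⟩
  exact ((hS.of_le (by norm_num)).comp_contDiffOn h1).congr hder

open Filter Topology in
lemma aux_second (w : ℂ → ℝ) (z e : ℂ) (hw : ContDiffAt ℝ 2 w z) :
    iteratedFDeriv ℝ 2 w z ![e, e] = deriv (deriv (fun s : ℝ => w (z + s • e))) 0 := by
  rw [iteratedFDeriv_two_apply]
  simp only [Matrix.cons_val_zero, Matrix.cons_val_one]
  have hl : ∀ s : ℝ, HasDerivAt (fun s : ℝ => z + s • e) e s := by
    intro s
    simpa using ((hasDerivAt_id s).smul_const e).const_add z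
  have hlt : Tendsto (fun s : ℝ => z + s • e) (𝓝 0) (𝓝 z) := by
    have := (hl 0).continuousAt.tendsto
    simpa using this
  have hev : ∀ᶠ y in 𝓝 z, DifferentiableAt ℝ w y := by
    filter_upwards [hw.eventually (by simp)] with y hy
    exact hy.differentiableAt (by norm_num)
  have h1 : deriv (fun s : ℝ => w (z + s • e)) =ᶠ[𝓝 0] fun s => fderiv ℝ w (z + s • e) e := by
    filter_upwards [hlt.eventually hev] with s hs
    exact (hs.hasFDerivAt.comp_hasDerivAt s (hl s)).deriv
  rw [h1.deriv_eq]
  have h2 : DifferentiableAt ℝ (fderiv ℝ w) z :=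
    (hw.fderiv_right (m := 1) (by norm_num)).differentiableAt (by norm_num)
  have h2' : HasFDerivAt (fderiv ℝ w) (fderiv ℝ (fderiv ℝ w) z) (z + (0:ℝ) • e) := by
    simpa using h2.hasFDerivAt
  have h3 := h2'.comp_hasDerivAt (0:ℝ) (hl 0)
  have h4 := h3.clm_apply (hasDerivAt_const (0:ℝ) e)
  have h5 : deriv (fun s : ℝ => fderiv ℝ w (z + s • e) e) 0 = _ := h4.deriv
  rw [h5]
  simp

open Filter Topology Metric InnerProductSpace in
lemma aux_harmonic (S T : ℝ → ℝ) (hS : ContDiff ℝ 2 S) (a δ : ℝ)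
    (hT : ∀ x, |x| < δ → a < T x ∧ 0 < S (T x) ∧ HasDerivAt T (S (T x)) x)
    (u : ℝ → ℝ → ℝ)
    (hu : ContDiffOn ℝ 2 (fun q : ℝ × ℝ => u q.1 q.2) {q : ℝ × ℝ | a < q.1})
    (hpde : ∀ t > a, ∀ θ : ℝ,
          deriv (deriv (fun s => u s θ)) t + (deriv S t / S t) * deriv (fun s => u s θ) t
            + (S t ^ 2)⁻¹ * deriv (deriv (fun φ => u t φ)) θ = 0) :
    HarmonicOnNhd (fun z : ℂ => u (T z.re) z.im) {z : ℂ | |z.re| < δ} := by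
  have hopen : IsOpen {z : ℂ | |z.re| < δ} :=
    isOpen_lt (by fun_prop) continuous_const
  have hJ : IsOpen {x : ℝ | |x| < δ} := isOpen_lt (by fun_prop) continuous_const
  have hO : IsOpen {q : ℝ × ℝ | a < q.1} := isOpen_lt continuous_const continuous_fst
  have hTc : ContDiffOn ℝ 2 T {x : ℝ | |x| < δ} :=
    aux_contDiffOn S T hS _ hJ fun x hx => (hT x hx).2.2
  have hwc : ∀ z ∈ {z : ℂ | |z.re| < δ}, ContDiffAt ℝ 2 (fun z : ℂ => u (T z.re) z.im) z := by
    intro z hz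
    have h1 : ContDiffAt ℝ 2 (fun q : ℝ × ℝ => u q.1 q.2) (T z.re, z.im) :=
      hu.contDiffAt (hO.mem_nhds (hT _ hz).1)
    have h2 : ContDiffAt ℝ 2 T z.re := hTc.contDiffAt (hJ.mem_nhds hz)
    have hre : ContDiffAt ℝ 2 (fun z : ℂ => z.re) z := Complex.reCLM.contDiff.contDiffAt
    have him : ContDiffAt ℝ 2 (fun z : ℂ => z.im) z := Complex.imCLM.contDiff.contDiffAt
    have h3 : ContDiffAt ℝ 2 (fun z : ℂ => (T z.re, z.im)) z :=
      (ContDiffAt.comp (g := T) z h2 hre).prodMk him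
    exact ContDiffAt.comp (g := fun q : ℝ × ℝ => u q.1 q.2) z h1 h3
  intro z hz
  refine ⟨hwc z hz, ?_⟩
  filter_upwards [hopen.mem_nhds hz] with z hz
  rw [laplacian_eq_iteratedFDeriv_complexPlane]
  simp only [Pi.zero_apply]
  rw [aux_second _ _ _ (hwc z hz), aux_second _ _ _ (hwc z hz)]
  obtain ⟨x, y⟩ := z
  simp only [Complex.add_re, Complex.add_im, Complex.real_smul, Complex.mul_re, Complex.mul_im,
    Complex.ofReal_re, Complex.ofReal_im, Complex.one_re, Complex.one_im, Complex.I_re,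
    Complex.I_im, mul_one, mul_zero, zero_mul, add_zero, sub_zero, zero_add]
  have hx : |x| < δ := hz
  obtain ⟨ha, hSp, hTd⟩ := hT x hx
  have e1 : deriv (deriv fun s => u (T x) (y + s)) 0 = deriv (deriv fun φ => u (T x) φ) y := by
    have : deriv (fun s => u (T x) (y + s)) = fun s => deriv (fun φ => u (T x) φ) (y + s) := by
      funext s
      exact deriv_comp_const_add (f := fun φ => u (T x) φ) y s
    rw [this, deriv_comp_const_add (f := deriv fun φ => u (T x) φ)]
    simp
  have e2 : deriv (deriv fun s => u (T (x + s)) y) 0 = deriv (deriv fun s => u (T s) y) x := by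
    have : deriv (fun s => u (T (x + s)) y) = fun s => deriv (fun s => u (T s) y) (x + s) := by
      funext s
      exact deriv_comp_const_add (f := fun s => u (T s) y) x s
    rw [this, deriv_comp_const_add (f := deriv fun s => u (T s) y)]
    simp
  have hf : ContDiffOn ℝ 2 (fun s => u s y) (Ioi a) := by
    have : ContDiffOn ℝ 2 (fun s : ℝ => (s, y)) (Ioi a) := by fun_prop
    exact hu.comp this (fun s hs => hs)
  have hf1 : ∀ t > a, HasDerivAt (fun s => u s y) (deriv (fun s => u s y) t) t := fun t ht =>
    ((hf.contDiffAt (isOpen_Ioi.mem_nhds ht)).differentiableAt (by norm_num)).hasDerivAt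
  have hf2 : ∀ t > a, HasDerivAt (deriv (fun s => u s y)) (deriv (deriv (fun s => u s y)) t) t := by
    intro t ht
    have h := hf
    rw [show (2 : WithTop ℕ∞) = 1 + 1 by norm_num,
      contDiffOn_succ_iff_deriv_of_isOpen isOpen_Ioi] at h
    exact ((h.2.2.contDiffAt (isOpen_Ioi.mem_nhds ht)).differentiableAt (by norm_num)).hasDerivAt
  have e3 : deriv (fun s => u (T s) y) =ᶠ[𝓝 x] fun s => deriv (fun s => u s y) (T s) * S (T s) := by
    filter_upwards [hJ.mem_nhds hx] with s hs
    obtain ⟨h1, h2, h3⟩ := hT s hs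
    exact (HasDerivAt.comp (h₂ := fun s => u s y) s (hf1 _ h1) h3).deriv
  have hSd : HasDerivAt S (deriv S (T x)) (T x) :=
    (hS.differentiable (by norm_num) _).hasDerivAt
  have e4 := ((HasDerivAt.comp x (hf2 _ ha) hTd).mul (HasDerivAt.comp x hSd hTd)).deriv
  rw [e1, e2, e3.deriv_eq]
  have e5 : deriv (fun s => deriv (fun s => u s y) (T s) * S (T s)) x = _ := e4
  rw [e5]
  have hp := hpde (T x) ha y
  simp only [Function.comp]
  field_simp at hp
  linear_combination hp

/-- Proposition 2.21: spherical Harnack inequality for two-dimensional Riemannian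
models. The model `(0,∞) × S¹` with metric `dr² + ψ²(r)dθ²` is described in polar
coordinates; `S = ψ` is its area function, harmonic functions `u(r,θ)` (2π-periodic
in `θ`) satisfy `∂ᵣᵣu + (S'/S)∂ᵣu + S^{-2}∂_{θθ}u = 0`, and the geodesic sphere
`∂B(x₀,r)` about the pole is `{r} × S¹`. Under the hypotheses (i) the ratio
`S''₊/S` varies slowly on annuli and (ii) `S(r)/r + √(S''₊(r)S(r)) ≤ N log r` for
large `r`, there are `r₀, C_H, N_H > 0` and `A > 1` such that every positive
harmonic function on the exterior `{t > A⁻¹ r}` with `r ≥ r₀` satisfies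
`sup_{∂B_r} u ≤ C_H r^{N_H} inf_{∂B_r} u`. -/
theorem stmt_16 (ψ : ℝ → ℝ) (hψ : ContDiff ℝ (⊤ : ℕ∞) ψ) (hψpos : ∀ r > (0:ℝ), 0 < ψ r)
    (S : ℝ → ℝ) (hS : S = ψ)
    (hi : ∀ A > (1:ℝ), ∃ c > (0:ℝ), ∃ r₁ > (0:ℝ), ∀ r ≥ r₁,
      ∀ t ∈ Ioo (A⁻¹ * r) (A * r),
        max (deriv (deriv S) t) 0 / S t ≤ c * (max (deriv (deriv S) r) 0 / S r))
    (N : ℝ) (hN : 0 < N)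
    (hii : ∃ r₂ > (0:ℝ), ∀ r ≥ r₂,
      S r / r + Real.sqrt (max (deriv (deriv S) r) 0 * S r) ≤ N * log r) :
    ∃ r₀ > (0:ℝ), ∃ C_H > (0:ℝ), ∃ N_H > (0:ℝ), ∃ A > (1:ℝ), ∀ r ≥ r₀,
      ∀ u : ℝ → ℝ → ℝ,
        (∀ t > A⁻¹ * r, ∀ θ : ℝ, 0 < u t θ) →
        (∀ t > A⁻¹ * r, ∀ θ : ℝ, u t (θ + 2 * π) = u t θ) →
        ContDiffOn ℝ 2 (fun q : ℝ × ℝ => u q.1 q.2) {q : ℝ × ℝ | A⁻¹ * r < q.1} →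
        (∀ t > A⁻¹ * r, ∀ θ : ℝ,
          deriv (deriv (fun s => u s θ)) t + (deriv S t / S t) * deriv (fun s => u s θ) t
            + (S t ^ 2)⁻¹ * deriv (deriv (fun φ => u t φ)) θ = 0) →
        ∀ θ₁ θ₂ : ℝ, u r θ₁ ≤ C_H * r ^ N_H * u r θ₂ := by
  have hScd : ContDiff ℝ 2 S := by rw [hS]; exact contDiff_infty.mp hψ 2
  have hSpos : ∀ t > (0:ℝ), 0 < S t := by rw [hS]; exact hψpos
  obtain ⟨r₂, hr₂, hb⟩ := hii
  refine ⟨max (2 * r₂) 2, by positivity, 9, by norm_num, 128 * N * log 3,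
    mul_pos (by positivity) (Real.log_pos (by norm_num)), 2, by norm_num, ?_⟩
  intro r hr u hupos huper huc hpde θ₁ θ₂
  have hr1 : 2 * r₂ ≤ r := (le_max_left _ _).trans hr
  have hr2 : 2 ≤ r := (le_max_right _ _).trans hr
  have hr0 : 0 < r := by linarith
  have hlog : 0 < log r := Real.log_pos (by linarith)
  have hlog2 : log (2 * r) ≤ 2 * log r := by
    rw [Real.log_mul (by norm_num) hr0.ne']
    have := Real.log_le_log (by norm_num) hr2
    linarith
  set K : ℝ := N * (2 * r) * (2 * log r) with hK
  have hKpos : 0 < K := by positivity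
  have hSb : ∀ t ∈ Icc (r / 2) (2 * r), S t ≤ K := by
    intro t ht
    have ht0 : 0 < t := by linarith [ht.1]
    have h1 := hb t (by linarith [ht.1])
    have h2 : S t / t ≤ N * log t := by
      have := Real.sqrt_nonneg (max (deriv (deriv S) t) 0 * S t)
      linarith
    rw [div_le_iff₀ ht0] at h2
    have h3 : log t ≤ 2 * log r := (Real.log_le_log ht0 ht.2).trans hlog2
    calc S t ≤ N * log t * t := h2
      _ ≤ N * (2 * log r) * t := by gcongr
      _ ≤ N * (2 * log r) * (2 * r) := by gcongr; exact ht.2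
      _ = K := by rw [hK]; ring
  obtain ⟨T, hT0, hT⟩ := aux_ode S hScd.continuous r K hr0 hKpos hSpos hSb
  set δ := r / (2 * K) with hδ
  have hδpos : 0 < δ := by positivity
  have ha : (2:ℝ)⁻¹ * r = r / 2 := by ring
  rw [ha] at hupos huper huc hpde
  have hharm := aux_harmonic S T hScd (r / 2) δ
    (fun x hx => ⟨(hT x hx).1.1, hSpos _ (by linarith [(hT x hx).1.1]), (hT x hx).2⟩) u huc hpde
  have hstep : ∀ x y, |x - y| ≤ δ / 2 → u r x ≤ 3 * u r y := by
    intro x y hxy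
    have hsub : ∀ z ∈ Metric.ball (⟨0, y⟩ : ℂ) δ, |z.re| < δ := by
      intro z hz
      rw [Metric.mem_ball, dist_eq_norm] at hz
      have := Complex.abs_re_le_norm (z - ⟨0, y⟩)
      simp at this
      linarith
    have h := aux_harnack_ball (fun z : ℂ => u (T z.re) z.im) ⟨0, y⟩ δ hδpos
      (fun z hz => hharm z (hsub z hz)) (fun z hz => hupos _ (hT _ (hsub z hz)).1.1 _)
      ⟨0, x - y⟩ (by
        have : (⟨0, x - y⟩ : ℂ) = ((x - y : ℝ) : ℂ) * Complex.I := by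
          apply Complex.ext <;> simp
        rw [this]
        simpa [← Complex.ofReal_sub] using hxy)
    simpa [hT0] using h
  have hper : Function.Periodic (fun θ => u r θ) (2 * π) := fun θ => huper r (by linarith) θ
  obtain ⟨y, hy, hyu⟩ := hper.exists_mem_Ico (by positivity) θ₂ θ₁
  have hyu' : u r θ₂ = u r y := hyu
  rw [hyu']
  have hypos : 0 < u r y := hupos r (by linarith) y
  set n := ⌈2 * π / (δ / 2)⌉₊ with hn
  have hn1 : 2 * π / (δ / 2) ≤ n := Nat.le_ceil _
  have hn2 : (n : ℝ) < 2 * π / (δ / 2) + 1 := Nat.ceil_lt_add_one (by positivity)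
  have hch := aux_chain (u r) (δ / 2) hstep n θ₁ y (by
    rw [div_le_iff₀ (by positivity)] at hn1
    rw [abs_sub_comm, abs_of_nonneg (by linarith [hy.1])]
    have := hy.2
    nlinarith)
  refine hch.trans ?_
  gcongr
  have h4 : 2 * π / (δ / 2) ≤ 128 * N * log r := by
    have : 2 * π / (δ / 2) = 32 * π * N * log r := by
      rw [hδ, hK]; field_simp; ring
    rw [this]
    have := Real.pi_le_four
    have h5 : 0 < N * log r := by positivity
    nlinarith
  have h6 : r ^ (128 * N * log 3) = (3:ℝ) ^ (128 * N * log r) := by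
    rw [Real.rpow_def_of_pos hr0, Real.rpow_def_of_pos (by norm_num)]
    congr 1; ring
  rw [h6, show (9:ℝ) = 3 ^ (2:ℝ) by norm_num, ← Real.rpow_add (by norm_num),
    ← Real.rpow_natCast]
  apply Real.rpow_le_rpow_of_exponent_le (by norm_num)
  push_cast
  linarith
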